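/- Let H be a real Hilbert space, let C ⊆ H be a nonempty closed convex set, and let f : H → ℝ be differentiable, strongly convex with modulus σ > 0, and with L-Lipschitz gradient (L > 0). Let z⋆ be the minimizer of f over C and let 0 < τ ≤ 1/L. Then for every z ∈ H and every gradient-evaluation error e ∈ H, the inexact projected gradient step satisfies ‖Proj_C(z − τ(∇f(z) + e)) − z⋆‖ ≤ (1 − τσ)‖z − z⋆‖ + τ‖e‖. -/

import Mathlib

open RealInnerProductSpace

theorem HasGradientAt.inner_sub_nonneg_of_isMinOn
    {H : Type*} [NormedAddCommGroup H] [InnerProductSpace ℝ H] [CompleteSpace H]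
    {C : Set H} (hC : Convex ℝ C) {f : H → ℝ} {a g : H} (hf : HasGradientAt f g a)
    (ha : a ∈ C) (hmin : IsMinOn f C a) {w : H} (hw : w ∈ C) : 0 ≤ ⟪g, w - a⟫ := by
  have h := hmin.localize.hasFDerivWithinAt_nonneg hf.hasFDerivAt.hasFDerivWithinAt
    (sub_mem_posTangentConeAt_of_segment_subset (hC.segment_subset ha hw))
  simpa using h

theorem hasGradientAt_half_mul_norm_sub_sq
    {H : Type*} [NormedAddCommGroup H] [InnerProductSpace ℝ H] [CompleteSpace H]
    (c : ℝ) (v x : H) : HasGradientAt (fun y => c / 2 * ‖y - v‖ ^ 2) (c • (x - v)) x := by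
  rw [hasGradientAt_iff_hasFDerivAt]
  refine ((((hasFDerivAt_id x).sub_const v).norm_sq).const_mul (c / 2)).congr_fderiv ?_
  ext y
  simp
  ring

theorem HasGradientAt.sub_fun
    {H : Type*} [NormedAddCommGroup H] [InnerProductSpace ℝ H] [CompleteSpace H]
    {f₁ f₂ : H → ℝ} {g₁ g₂ x : H} (h₁ : HasGradientAt f₁ g₁ x) (h₂ : HasGradientAt f₂ g₂ x) :
    HasGradientAt (fun y => f₁ y - f₂ y) (g₁ - g₂) x := by
  rw [hasGradientAt_iff_hasFDerivAt, map_sub]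
  exact h₁.hasFDerivAt.sub h₂.hasFDerivAt

/-- The first-order inequality for a function with monotone gradient. -/
theorem add_inner_gradient_le_of_monotone
    {H : Type*} [NormedAddCommGroup H] [InnerProductSpace ℝ H] [CompleteSpace H]
    {f : H → ℝ} {g : H → H} (hf : ∀ x, HasGradientAt f (g x) x)
    (hg : ∀ x y, 0 ≤ ⟪g x - g y, x - y⟫) (x y : H) : f x + ⟪g x, y - x⟫ ≤ f y := by
  have hderiv (t : ℝ) : HasDerivAt (fun t : ℝ => f (x + t • (y - x)) - t * ⟪g x, y - x⟫)
      (⟪g (x + t • (y - x)) - g x, y - x⟫) t := by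
    have hline : HasDerivAt (fun t : ℝ => x + t • (y - x)) (y - x) t := by
      simpa using ((hasDerivAt_id t).smul_const (y - x)).const_add x
    have h := ((hf (x + t • (y - x))).hasFDerivAt.comp_hasDerivAt t hline).sub
      ((hasDerivAt_id t).mul_const ⟪g x, y - x⟫)
    exact h.congr_deriv (by simp [inner_sub_left])
  have hmono : MonotoneOn (fun t : ℝ => f (x + t • (y - x)) - t * ⟪g x, y - x⟫)
      (Set.Icc 0 1) := by
    refine monotoneOn_of_deriv_nonneg (convex_Icc 0 1)
      (fun t _ => (hderiv t).continuousAt.continuousWithinAt)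
      (fun t _ => (hderiv t).differentiableAt.differentiableWithinAt) fun t ht => ?_
    rw [interior_Icc] at ht
    rw [(hderiv t).deriv]
    have h := hg (x + t • (y - x)) x
    rw [add_sub_cancel_left, real_inner_smul_right] at h
    exact nonneg_of_mul_nonneg_right h ht.1
  have h := hmono (by simp) (by simp) zero_le_one
  simp at h
  linarith

/-- Division-free form of the Baillon–Haddad cocoercivity inequality. -/
theorem mul_norm_gradient_sub_sq_le_inner
    {H : Type*} [NormedAddCommGroup H] [InnerProductSpace ℝ H] [CompleteSpace H]
    {f : H → ℝ} {g : H → H} {M : ℝ} (hf : ∀ x, HasGradientAt f (g x) x)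
    (hg : ∀ x y, 0 ≤ ⟪g x - g y, x - y⟫)
    (hM : ∀ x y, ⟪g x - g y, x - y⟫ ≤ M * ‖x - y‖ ^ 2) (s : ℝ) (x y : H) :
    (2 * s - M * s ^ 2) * ‖g x - g y‖ ^ 2 ≤ ⟪g x - g y, x - y⟫ := by
  have hupper (x y : H) : f y ≤ f x + ⟪g x, y - x⟫ + M / 2 * ‖y - x‖ ^ 2 := by
    have h := add_inner_gradient_le_of_monotone
      (fun z => (hasGradientAt_half_mul_norm_sub_sq M x z).sub_fun (hf z)) (fun a b => by
        have h := hM a b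
        rw [show M • (a - x) - g a - (M • (b - x) - g b) = M • (a - b) - (g a - g b) by module,
          inner_sub_left, real_inner_smul_left, real_inner_self_eq_norm_sq]
        linarith) x y
    simp [inner_neg_left] at h
    linarith
  have hhalf (x y : H) :
      f x + ⟪g x, y - x⟫ + (s - M / 2 * s ^ 2) * ‖g x - g y‖ ^ 2 ≤ f y := by
    have h₁ := add_inner_gradient_le_of_monotone hf hg x (y + s • (g x - g y))
    have h₂ := hupper y (y + s • (g x - g y))
    rw [show y + s • (g x - g y) - x = (y - x) + s • (g x - g y) by abel, inner_add_right,
      real_inner_smul_right] at h₁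
    rw [add_sub_cancel_left, real_inner_smul_right, norm_smul, mul_pow, Real.norm_eq_abs,
      sq_abs] at h₂
    have h₃ : ⟪g x, g x - g y⟫ - ⟪g y, g x - g y⟫ = ‖g x - g y‖ ^ 2 := by
      rw [← inner_sub_left, real_inner_self_eq_norm_sq]
    linear_combination h₁ + h₂ - s * h₃
  have h₁ := hhalf x y
  have h₂ := hhalf y x
  rw [norm_sub_rev (g y)] at h₂
  rw [← neg_sub x y, inner_neg_right] at h₁
  rw [inner_sub_left]
  linarith

/-- A gradient step with step size at most `1 / L` contracts with factor `1 - τ * σ`. -/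
theorem norm_gradient_step_sub_le
    {H : Type*} [NormedAddCommGroup H] [InnerProductSpace ℝ H] [CompleteSpace H]
    {f : H → ℝ} {g : H → H} (hf : ∀ x, HasGradientAt f (g x) x)
    {L σ τ : ℝ} (hL : 0 < L)
    (hLip : ∀ x y : H, ‖g x - g y‖ ≤ L * ‖x - y‖)
    (hStrong : ∀ x y : H, σ * ‖x - y‖ ^ 2 ≤ ⟪g x - g y, x - y⟫)
    (hτ0 : 0 < τ) (hτL : τ ≤ 1 / L) (x y : H) :
    ‖(x - τ • g x) - (y - τ • g y)‖ ≤ (1 - τ * σ) * ‖x - y‖ := by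
  rcases eq_or_ne x y with rfl | hxy
  · simp
  have hinner (a b : H) : ⟪g a - g b, a - b⟫ ≤ L * ‖a - b‖ ^ 2 := by
    nlinarith [real_inner_le_norm (g a - g b) (a - b), hLip a b, norm_nonneg (a - b)]
  have hpos : 0 < ‖x - y‖ ^ 2 := pow_pos (norm_pos_iff.2 (sub_ne_zero.2 hxy)) 2
  have hσL : σ ≤ L := le_of_mul_le_mul_right ((hStrong x y).trans (hinner x y)) hpos
  have hτL' : τ * L ≤ 1 := (le_div_iff₀ hL).1 hτL
  have hτσ : 0 ≤ 1 - τ * σ := by nlinarith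
  let G : H → H := fun z => g z - σ • (z - 0)
  have hGsub (a b : H) : G a - G b = (g a - g b) - σ • (a - b) := by
    simp only [G]; module
  have hGinner (a b : H) : ⟪G a - G b, a - b⟫ = ⟪g a - g b, a - b⟫ - σ * ‖a - b‖ ^ 2 := by
    rw [hGsub, inner_sub_left, real_inner_smul_left, real_inner_self_eq_norm_sq]
  have hGmono (a b : H) : 0 ≤ ⟪G a - G b, a - b⟫ := by
    rw [hGinner]; linarith [hStrong a b]
  have hGupper (a b : H) : ⟪G a - G b, a - b⟫ ≤ (L - σ) * ‖a - b‖ ^ 2 := by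
    rw [hGinner]; linarith [hinner a b]
  have hco (s : ℝ) := mul_norm_gradient_sub_sq_le_inner
    (fun z => (hf z).sub_fun (hasGradientAt_half_mul_norm_sub_sq σ 0 z)) hGmono hGupper s x y
  have hkey : τ * ‖G x - G y‖ ^ 2 ≤ 2 * (1 - τ * σ) * ⟪G x - G y, x - y⟫ := by
    change ∀ s : ℝ, (2 * s - (L - σ) * s ^ 2) * ‖G x - G y‖ ^ 2 ≤ ⟪G x - G y, x - y⟫ at hco
    have h₀ := hGmono x y
    have h₁ := hGupper x y
    rcases hσL.eq_or_lt with rfl | hlt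
    · have h₂ := hco τ
      nlinarith
    · have hM : 0 < L - σ := sub_pos.2 hlt
      have h₂ := hco (1 / (L - σ))
      rw [show 2 * (1 / (L - σ)) - (L - σ) * (1 / (L - σ)) ^ 2 = 1 / (L - σ) by
        field_simp; ring, div_mul_eq_mul_div, one_mul, div_le_iff₀ hM] at h₂
      nlinarith [mul_le_mul_of_nonneg_left h₂ hτ0.le,
        mul_nonneg (by nlinarith : 0 ≤ 2 * (1 - τ * σ) - τ * (L - σ)) h₀]
  refine le_of_sq_le_sq ?_ (mul_nonneg hτσ (norm_nonneg _))
  rw [show (x - τ • g x) - (y - τ • g y) = (1 - τ * σ) • (x - y) - τ • (G x - G y) by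
    rw [hGsub]; module, norm_sub_sq_real, real_inner_smul_left, real_inner_smul_right,
    norm_smul, norm_smul, mul_pow, mul_pow, mul_pow, Real.norm_eq_abs, Real.norm_eq_abs, sq_abs,
    sq_abs, real_inner_comm]
  nlinarith [mul_le_mul_of_nonneg_left hkey hτ0.le]

/-- **Inexact projected gradient step.**
Let `C` be a nonempty closed convex subset of a real Hilbert space `H`, and
`f : H → ℝ` differentiable (with gradient `g`), strongly convex with modulus
`σ > 0`, with `L`-Lipschitz gradient (`L > 0`). Let `z⋆` be the minimizer of
`f` over `C` and `0 < τ ≤ 1/L`. Then for every `z` and every gradient error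
`e`, `‖Proj_C (z - τ • (g z + e)) - z⋆‖ ≤ (1 - τσ) ‖z - z⋆‖ + τ ‖e‖`. -/
theorem inexact_projected_gradient_step
    {H : Type*} [NormedAddCommGroup H] [InnerProductSpace ℝ H] [CompleteSpace H]
    (C : Set H) (hCne : C.Nonempty) (hCclosed : IsClosed C) (hCconv : Convex ℝ C)
    (f : H → ℝ) (g : H → H)
    (hdiff : ∀ x : H, HasGradientAt f (g x) x)
    (L σ : ℝ) (hL : 0 < L) (hσ : 0 < σ)
    (hLip : ∀ x y : H, ‖g x - g y‖ ≤ L * ‖x - y‖)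
    (hStrong : ∀ x y : H, σ * ‖x - y‖ ^ 2 ≤ ⟪g x - g y, x - y⟫)
    (zstar : H) (hzC : zstar ∈ C) (hmin : ∀ w ∈ C, f zstar ≤ f w)
    (Proj : H → H)
    (hProj : ∀ v : H, Proj v ∈ C ∧ ∀ w ∈ C, ‖Proj v - v‖ ≤ ‖w - v‖)
    (τ : ℝ) (hτ0 : 0 < τ) (hτL : τ ≤ 1 / L) :
    ∀ (z : H) (e : H),
      ‖Proj (z - τ • (g z + e)) - zstar‖ ≤ (1 - τ * σ) * ‖z - zstar‖ + τ * ‖e‖ := by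
  intro z e
  set v := z - τ • (g z + e) with hv
  obtain ⟨hpC, hpmin⟩ := hProj v
  set p := Proj v
  have hproj : 0 ≤ ⟪p - v, zstar - p⟫ := by
    have h := (hasGradientAt_half_mul_norm_sub_sq 1 v p).inner_sub_nonneg_of_isMinOn hCconv hpC
      (fun w hw => by
        have := hpmin w hw
        change 1 / 2 * ‖p - v‖ ^ 2 ≤ 1 / 2 * ‖w - v‖ ^ 2
        gcongr) hzC
    simpa using h
  have hopt : 0 ≤ ⟪g zstar, p - zstar⟫ :=
    (hdiff zstar).inner_sub_nonneg_of_isMinOn hCconv hzC hmin hpC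
  have hle : ‖p - zstar‖ ≤ ‖v - (zstar - τ • g zstar)‖ := by
    have hsum : ‖p - zstar‖ ^ 2 ≤ ⟪v - (zstar - τ • g zstar), p - zstar⟫ := by
      have hdecomp : v - (zstar - τ • g zstar) = (p - zstar) - (p - v) + τ • g zstar := by
        module
      rw [← neg_sub p zstar, inner_neg_right] at hproj
      rw [hdecomp, inner_add_left, inner_sub_left, real_inner_smul_left,
        real_inner_self_eq_norm_sq]
      nlinarith
    have hcs := hsum.trans (real_inner_le_norm _ _)
    by_contra! hlt
    nlinarith [norm_nonneg (v - (zstar - τ • g zstar))]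
  calc
    ‖p - zstar‖ ≤ ‖(z - τ • g z) - (zstar - τ • g zstar) - τ • e‖ := by
      rwa [show (z - τ • g z) - (zstar - τ • g zstar) - τ • e = v - (zstar - τ • g zstar) by
        rw [hv]; module]
    _ ≤ ‖(z - τ • g z) - (zstar - τ • g zstar)‖ + ‖τ • e‖ := norm_sub_le _ _
    _ ≤ (1 - τ * σ) * ‖z - zstar‖ + τ * ‖e‖ := by
      rw [norm_smul, Real.norm_of_nonneg hτ0.le]
      gcongr
      exact norm_gradient_step_sub_le hdiff hL hLip hStrong hτ0 hτL z zstar
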